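/- Let L be an n-dimensional null-filiform Leibniz algebra over a field K, i.e., an n-dimensional Leibniz algebra whose lower central series (L^1 = L, L^{k+1} = span{xy : x ∈ L^k, y ∈ L}) satisfies dim_K L^i = n + 1 − i for all 1 ≤ i ≤ n + 1. Then L is isomorphic as a K-algebra to L_n, the K-vector space with basis e_1, …, e_n and multiplication determined by e_i·e_1 = e_{i+1} for 1 ≤ i ≤ n − 1 and all other products of basis elements equal to zero. -/

import Mathlib

/-- The multiplication of the `n`-dimensional null-filiform Leibniz algebra `L_n`,
realized on coordinate vectors `Fin n → K`: the bilinear map determined by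
`e_i · e_1 = e_{i+1}` for `1 ≤ i ≤ n-1` and all other products of basis vectors zero. -/
def nfMul (K : Type*) [Field K] (n : ℕ) (x y : Fin n → K) : Fin n → K :=
  fun k => if (k : ℕ) = 0 then 0
    else y ⟨0, Nat.lt_of_le_of_lt (Nat.zero_le _) k.isLt⟩ *
         x ⟨(k : ℕ) - 1, Nat.lt_of_le_of_lt (Nat.sub_le _ _) k.isLt⟩

/-- The lower central series of a (nonunital, nonassociative) algebra `L` over `K`,
indexed so that `lcs K L (k - 1) = L^k`: `lcs K L 0 = L` and
`lcs K L (k+1) = span {x * y : x ∈ lcs K L k, y ∈ L}`. -/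
def lcs (K L : Type*) [Field K] [NonUnitalNonAssocRing L] [Module K L] :
    ℕ → Submodule K L
  | 0 => ⊤
  | k + 1 => Submodule.span K {z | ∃ x ∈ lcs K L k, ∃ y : L, z = x * y}

theorem nf_lcs_mul (K L : Type*) [Field K] [NonUnitalNonAssocRing L] [Module K L]
    (k : ℕ) (x y : L) (hx : x ∈ lcs K L k) : x * y ∈ lcs K L (k + 1) :=
  Submodule.subset_span ⟨x, hx, y, rfl⟩

theorem nf_lcs_mul_lcs_one (K L : Type*) [Field K]
    [NonUnitalNonAssocRing L] [Module K L] [SMulCommClass K L L] [IsScalarTower K L L]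
    (leibniz : ∀ x y z : L, x * (y * z) = (x * y) * z - (x * z) * y)
    (k : ℕ) (x y : L) (hx : x ∈ lcs K L k) (hy : y ∈ lcs K L 1) :
    x * y ∈ lcs K L (k + 2) := by
  have h : lcs K L 1 ≤ (lcs K L (k + 2)).comap (LinearMap.mulLeft K x) := by
    refine Submodule.span_le.2 ?_
    rintro z ⟨a, -, b, rfl⟩
    change x * (a * b) ∈ lcs K L (k + 2)
    rw [leibniz]
    exact Submodule.sub_mem _
      (nf_lcs_mul K L _ _ _ (nf_lcs_mul K L _ _ _ hx))
      (nf_lcs_mul K L _ _ _ (nf_lcs_mul K L _ _ _ hx))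
  exact h hy

/-- Iterated right multiplication by `e`. -/
def nfPow {L : Type*} [NonUnitalNonAssocRing L] (e : L) : ℕ → L
  | 0 => e
  | k + 1 => nfPow e k * e

theorem nfPow_mem (K L : Type*) [Field K] [NonUnitalNonAssocRing L] [Module K L]
    (e : L) (k : ℕ) : nfPow e k ∈ lcs K L k := by
  induction k with
  | zero => exact Submodule.mem_top
  | succ k ih => exact nf_lcs_mul K L _ _ _ ih

theorem mul_nfPow_succ {L : Type*} [NonUnitalNonAssocRing L]
    (leibniz : ∀ x y z : L, x * (y * z) = (x * y) * z - (x * z) * y)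
    (e : L) (k : ℕ) (x : L) : x * nfPow e (k + 1) = 0 := by
  induction k generalizing x with
  | zero => simp [nfPow, leibniz]
  | succ k ih =>
    rw [nfPow, leibniz, ih, ih]; simp

theorem nf_lcs_le (K L : Type*) [Field K]
    [NonUnitalNonAssocRing L] [Module K L] [SMulCommClass K L L] [IsScalarTower K L L]
    (leibniz : ∀ x y z : L, x * (y * z) = (x * y) * z - (x * z) * y)
    (e : L) (he : (⊤ : Submodule K L) ≤ Submodule.span K {e} ⊔ lcs K L 1) (k : ℕ) :
    lcs K L k ≤ Submodule.span K {nfPow e k} ⊔ lcs K L (k + 1) := by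
  induction k with
  | zero => exact le_trans le_top he
  | succ k ih =>
    refine Submodule.span_le.2 ?_
    rintro z ⟨x, hx, y, rfl⟩
    obtain ⟨u, hu, v, hv, rfl⟩ := Submodule.mem_sup.1 (ih hx)
    obtain ⟨a, rfl⟩ := Submodule.mem_span_singleton.1 hu
    obtain ⟨u', hu', w, hw, rfl⟩ := Submodule.mem_sup.1 (he (Submodule.mem_top (x := y)))
    obtain ⟨b, rfl⟩ := Submodule.mem_span_singleton.1 hu'
    have h1 := nf_lcs_mul_lcs_one K L leibniz k _ w (nfPow_mem K L e k) hw
    have h2 := nf_lcs_mul K L (k + 1) v (b • e + w) hv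
    refine Submodule.mem_sup.2 ⟨(a * b) • nfPow e (k + 1),
      Submodule.mem_span_singleton.2 ⟨_, rfl⟩, a • (nfPow e k * w) + v * (b • e + w),
      Submodule.add_mem _ (Submodule.smul_mem _ _ h1) h2, ?_⟩
    rw [add_mul, mul_add (a • nfPow e k), smul_mul_smul_comm, smul_mul_assoc, nfPow, add_assoc]

theorem nf_top_le (K L : Type*) [Field K]
    [NonUnitalNonAssocRing L] [Module K L] [SMulCommClass K L L] [IsScalarTower K L L]
    (leibniz : ∀ x y z : L, x * (y * z) = (x * y) * z - (x * z) * y)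
    (e : L) (he : (⊤ : Submodule K L) ≤ Submodule.span K {e} ⊔ lcs K L 1) (k : ℕ) :
    ⊤ ≤ Submodule.span K (Set.range fun i : Fin k => nfPow e i) ⊔ lcs K L k := by
  induction k with
  | zero => exact le_sup_of_le_right le_rfl
  | succ k ih =>
    refine ih.trans (sup_le ?_ ((nf_lcs_le K L leibniz e he k).trans (sup_le ?_ le_sup_right)))
    · refine le_sup_of_le_left (Submodule.span_mono ?_)
      rintro _ ⟨i, rfl⟩
      exact ⟨i.castSucc, rfl⟩
    · refine le_sup_of_le_left (Submodule.span_mono ?_)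
      rintro _ rfl
      exact ⟨Fin.last k, rfl⟩

/-- Every `n`-dimensional null-filiform Leibniz algebra `L` over a field `K` (i.e. an
`n`-dimensional Leibniz algebra whose lower central series satisfies
`dim_K L^i = n + 1 − i` for `1 ≤ i ≤ n + 1`) is isomorphic as a `K`-algebra to `L_n`,
the algebra with basis `e_1, …, e_n` and multiplication `e_i · e_1 = e_{i+1}`
(`1 ≤ i ≤ n − 1`), all other products of basis vectors being zero. -/
theorem null_filiform_classification (K L : Type*) [Field K]
    [NonUnitalNonAssocRing L] [Module K L] [SMulCommClass K L L] [IsScalarTower K L L]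
    (leibniz : ∀ x y z : L, x * (y * z) = (x * y) * z - (x * z) * y)
    (n : ℕ) (hn : 1 ≤ n) [FiniteDimensional K L]
    (hdim : Module.finrank K L = n)
    (hlcs : ∀ i : ℕ, 1 ≤ i → i ≤ n + 1 →
      Module.finrank K (lcs K L (i - 1)) = n + 1 - i) :
    ∃ φ : L ≃ₗ[K] (Fin n → K), ∀ x y : L, φ (x * y) = nfMul K n (φ x) (φ y) := by
  have h1 : Module.finrank K (lcs K L 1) = n - 1 := by
    have := hlcs 2 (by omega) (by omega)
    simpa using this
  have h0 : lcs K L n = ⊥ := by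
    have := hlcs (n + 1) (by omega) (by omega)
    simp only [Nat.sub_self] at this
    exact Submodule.finrank_eq_zero.1 this
  obtain ⟨e, he⟩ : ∃ e : L, e ∉ lcs K L 1 := by
    by_contra! h
    have : lcs K L 1 = ⊤ := Submodule.eq_top_iff'.2 h
    rw [this, finrank_top] at h1
    omega
  have hlt : lcs K L 1 < Submodule.span K {e} ⊔ lcs K L 1 := by
    refine lt_of_le_of_ne le_sup_right fun h => he ?_
    rw [h]
    exact Submodule.mem_sup_left (Submodule.mem_span_singleton_self e)
  have htop : (⊤ : Submodule K L) ≤ Submodule.span K {e} ⊔ lcs K L 1 := by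
    have h2 := Submodule.finrank_lt_finrank_of_lt hlt
    have h3 := Submodule.finrank_le (Submodule.span K {e} ⊔ lcs K L 1)
    exact (Submodule.eq_top_of_finrank_eq (by omega)).ge
  have hspan := nf_top_le K L leibniz e htop n
  rw [h0, sup_bot_eq] at hspan
  have hli : LinearIndependent K (fun i : Fin n => nfPow e i) :=
    linearIndependent_of_top_le_span_of_card_eq_finrank hspan (by simp [hdim])
  let b := Module.Basis.mk hli hspan
  have hb : ∀ i : Fin n, b i = nfPow e i := fun i => by simp [b]
  have hen : nfPow e n = 0 := by
    have := nfPow_mem K L e n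
    rwa [h0, Submodule.mem_bot] at this
  let z : Fin n := ⟨0, hn⟩
  have hright : ∀ x y : L, x * y = b.equivFun y z • (x * e) := by
    intro x y
    conv_lhs => rw [← b.sum_equivFun y]
    rw [Finset.mul_sum, Finset.sum_eq_single z]
    · rw [mul_smul_comm, hb]; rfl
    · rintro ⟨j, hj⟩ - hne
      obtain _ | j := j
      · exact absurd rfl hne
      · rw [mul_smul_comm, hb]
        change _ • (x * nfPow e (j + 1)) = 0
        rw [mul_nfPow_succ leibniz, smul_zero]
    · simp
  have hcoord : ∀ (i k : Fin n), b.equivFun (nfPow e (i + 1)) k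
      = if (k : ℕ) = i + 1 then 1 else 0 := by
    intro i k
    by_cases hi : (i : ℕ) + 1 < n
    · have : nfPow e (i + 1) = b ⟨i + 1, hi⟩ := (hb ⟨i + 1, hi⟩).symm
      rw [this, Module.Basis.equivFun_self]
      simp only [Fin.ext_iff, eq_comm]
    · have h : (i : ℕ) + 1 = n := by omega
      rw [h, hen, if_neg (by omega)]
      simp
  refine ⟨b.equivFun, fun x y => ?_⟩
  rw [hright x y]
  have hx : x * e = ∑ i, b.equivFun x i • nfPow e (i + 1) := by
    conv_lhs => rw [← b.sum_equivFun x]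
    rw [Finset.sum_mul]
    refine Finset.sum_congr rfl fun i _ => ?_
    rw [smul_mul_assoc, hb]; rfl
  funext k
  rw [map_smul, hx, map_sum]
  simp only [Pi.smul_apply, Finset.sum_apply, map_smul, hcoord, smul_eq_mul, nfMul]
  split_ifs with hk
  · rw [Finset.sum_eq_zero, mul_zero]
    intro i _
    rw [if_neg (by omega), mul_zero]
  · rw [Finset.sum_eq_single ⟨(k : ℕ) - 1, by omega⟩]
    · rw [if_pos (by simp only []; omega), mul_one]
    · intro i _ hne
      rw [if_neg, mul_zero]
      intro h
      exact hne (Fin.ext (by simp only []; omega))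
    · simp
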